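/- arXiv:2207.08550 — 2 statements merged into one kernel-verified Lean document; each statement's English description precedes it below -/
import Mathlib

section
/- There exist real numbers R, t₁, t₂ with 1 < R < 2 and 0 < t₁ < t₂ < 1 satisfying (i) R·t₁ = t₁ + (1 − √(R−1))/2, (ii) R·t₂ = (2 + t₁ + t₂)/2 − √(R−1)·(t₂ − t₁)/2, and (iii) R = 1 + (t₁ + t₂)/2, and moreover satisfying the numeric localization 1.5460 < R < 1.5462, 0.2389 < t₁ < 0.2390, and 0.8532 < t₂ < 0.8533. -/
theorem stmt_8 :
    ∃ R t₁ t₂ : ℝ,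
      1 < R ∧ R < 2 ∧ 0 < t₁ ∧ t₁ < t₂ ∧ t₂ < 1 ∧
      R * t₁ = t₁ + (1 - Real.sqrt (R - 1)) / 2 ∧
      R * t₂ = (2 + t₁ + t₂) / 2 - Real.sqrt (R - 1) * (t₂ - t₁) / 2 ∧
      R = 1 + (t₁ + t₂) / 2 ∧
      1.5460 < R ∧ R < 1.5462 ∧
      0.2389 < t₁ ∧ t₁ < 0.2390 ∧
      0.8532 < t₂ ∧ t₂ < 0.8533 := by
  have hc : ContinuousOn (fun s : ℝ => (1+s^2)*(4*s^4-(1-s)) - 2*s^2*(1+s^2) + 2*s^5 - s*(1-s))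
      (Set.Icc 0.738983 0.738985) := by fun_prop
  obtain ⟨s, ⟨h1, h2⟩, hs⟩ := intermediate_value_Icc (by norm_num) hc
    (show (0:ℝ) ∈ Set.Icc _ _ by constructor <;> norm_num)
  simp only at hs
  have hs0 : 0 < s := by linarith
  have hq1 : 0.546095 < s^2 := by nlinarith
  have hq2 : s^2 < 0.546099 := by nlinarith
  have hsq : Real.sqrt (1 + s^2 - 1) = s := by
    rw [add_sub_cancel_left]; exact Real.sqrt_sq hs0.le
  obtain ⟨t, ht⟩ : ∃ t : ℝ, t = (1-s)/(2*s^2) := ⟨_, rfl⟩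
  have hp : 0 < 2*s^2 := by positivity
  have hts : t * (2*s^2) = 1 - s := by rw [ht]; field_simp
  have ht1 : 0.23898 < t := by rw [ht, lt_div_iff₀ hp]; linarith
  have ht2 : t < 0.238986 := by rw [ht, div_lt_iff₀ hp]; nlinarith
  have hq3 : 0.5460958 < s^2 := by nlinarith
  refine ⟨1 + s^2, t, 2*s^2 - t, by linarith, by linarith, by linarith, by linarith,
    by linarith, ?_, ?_, by ring, by linarith, by linarith, by linarith, by linarith,
    by linarith, by linarith⟩
  · rw [hsq]; linarith
  · rw [hsq]
    apply mul_right_cancel₀ hp.ne'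
    linear_combination hs - (1 + s^2 + s) * hts
end

section
/- Let p > 0, r ≥ 0, and m₁, m₂ be real numbers with r ≤ m₁ ≤ m₂, and let k, κ be natural numbers with 2 ≤ k and κ ≤ k. Define N = ((k−κ)²/4)·p + (k−κ)·m₂ + (κ²/2)·p + κ·m₁ and D = (k²/4)·p + k·r. Then D > 0 and ( N + (k/2)·p + (1/4)·p ) / ( D + (k/2)·p ) ≤ max( N/D , 5/4 ). -/
theorem stmt_15 (p r m₁ m₂ : ℝ) (hp : 0 < p) (hr : 0 ≤ r)
    (hrm : r ≤ m₁) (hm : m₁ ≤ m₂) (k κ : ℕ) (hk : 2 ≤ k) (hκ : κ ≤ k)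
    (N D : ℝ)
    (hN : N = (((k : ℝ) - κ) ^ 2 / 4) * p + ((k : ℝ) - κ) * m₂
            + ((κ : ℝ) ^ 2 / 2) * p + (κ : ℝ) * m₁)
    (hD : D = ((k : ℝ) ^ 2 / 4) * p + (k : ℝ) * r) :
    0 < D ∧
    (N + ((k : ℝ) / 2) * p + (1 / 4) * p) / (D + ((k : ℝ) / 2) * p)
      ≤ max (N / D) (5 / 4) := by
  have hk' : (2 : ℝ) ≤ k := by exact_mod_cast hk
  have hD0 : 0 < D := by
    rw [hD]
    have : 0 < (k : ℝ) := by linarith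
    positivity
  refine ⟨hD0, ?_⟩
  have hkp : 2 * p ≤ k * p := mul_le_mul_of_nonneg_right hk' hp.le
  have h1 : N ≤ max (N / D) (5 / 4) * D := (div_le_iff₀ hD0).mp (le_max_left _ _)
  have h2 : 5 / 4 * ((k : ℝ) / 2 * p) ≤ max (N / D) (5 / 4) * ((k : ℝ) / 2 * p) :=
    mul_le_mul_of_nonneg_right (le_max_right _ _) (by positivity)
  rw [div_le_iff₀ (by positivity), mul_add]
  linarith
end
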